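/- arXiv:0902.3429 — 2 statements merged into one kernel-verified Lean document; each statement's English description precedes it below -/
import Mathlib

section
/- Let 𝒯 be a tiling which satisfies Δ. Then the subgroup H = {σ ∈ G : 𝒯σ = 𝒯} is discrete; indeed, for every η > 0 and all x,y ∈ E the set {σ ∈ H : xσ ∈ β(y,η)} is finite. (Proposition 1.8) -/
open Set Metric

namespace Paper

variable {E : Type*} [MetricSpace E]

/-- Image of a tile under an isometry (right action of `σ` on tiles). -/
def tmap (σ : E ≃ᵢ E) (T : Set E) : Set E := σ '' T

/-- Image of a set of tiles under an isometry. -/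
def smap (σ : E ≃ᵢ E) (ℰ : Set (Set E)) : Set (Set E) := tmap σ '' ℰ

/-- `bt ℰ T n` is the set `B_n^ℰ(T)` of tiles of `ℰ` at combinatorial distance at most `n`
from `T`. -/
def bt (ℰ : Set (Set E)) (T : Set E) : ℕ → Set (Set E)
  | 0 => {T}
  | n + 1 => {U | U ∈ ℰ ∧ ∃ V ∈ bt ℰ T n, (U ∩ V).Nonempty}

/-- A tile is a closed bounded subset of `E`. -/
def IsTile (T : Set E) : Prop := IsClosed T ∧ Bornology.IsBounded T

variable (G : Subgroup (E ≃ᵢ E))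

/-- `(ℰ,T) ≅ (ℰ',T')` modulo `G`. -/
def PIso (ℰ : Set (Set E)) (T : Set E) (ℰ' : Set (Set E)) (T' : Set E) : Prop :=
  ∃ σ ∈ G, smap σ ℰ = ℰ' ∧ tmap σ T = T'

/-- `(ℰ,T) ≤ (ℰ',T')` modulo `G`. -/
def PLe (ℰ : Set (Set E)) (T : Set E) (ℰ' : Set (Set E)) (T' : Set E) : Prop :=
  ∃ σ ∈ G, smap σ ℰ ⊆ ℰ' ∧ tmap σ T = T'

/-- A `p`-configuration. -/
def IsConfig (p : ℕ) (ℰ : Set (Set E)) (T : Set E) : Prop :=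
  ℰ.Finite ∧ T ∈ ℰ ∧ (∀ S ∈ ℰ, IsTile S) ∧ bt ℰ T p = ℰ ∧
    ∀ S ∈ bt ℰ T (p - 1), S ⊆ interior (⋃₀ (bt ℰ S 1))

/-- A `p`-local rule: a finite family of pairwise nonisomorphic `p`-configurations
satisfying the two compatibility conditions. -/
structure LocalRule (E : Type*) [MetricSpace E] (G : Subgroup (E ≃ᵢ E)) where
  p : ℕ
  hp : 1 ≤ p
  m : ℕ
  C : Fin m → Set (Set E)
  c : Fin m → Set E
  config : ∀ i, IsConfig p (C i) (c i)
  nonIso : ∀ i j, i ≠ j → ¬ PIso G (C i) (c i) (C j) (c j)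
  cond1 : ∀ i j, PLe G (bt (C i) (c i) 1) (c i) (bt (C j) (c j) 1) (c j) →
    PIso G (bt (C i) (c i) 1) (c i) (bt (C j) (c j) 1) (c j)
  cond2 : ∀ i, ∀ S ∈ bt (C i) (c i) 1, ∃ j,
    PIso G (bt (C i) S (p - 1)) S (bt (C j) (c j) (p - 1)) (c j)

/-- A set of tiles satisfies a local rule `Γ` if each `(B_p^ℰ(T),T)` is isomorphic
to one of the configurations of `Γ`. -/
def Satisfies (Γ : LocalRule E G) (ℰ : Set (Set E)) : Prop :=
  ∀ T ∈ ℰ, ∃ i, PIso G (bt ℰ T Γ.p) T (Γ.C i) (Γ.c i)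

/-- The pairs `(B_r^ℰ(T),T)`, `T ∈ ℰ`, fall into finitely many isomorphism classes. -/
def FinClasses (ℰ : Set (Set E)) (r : ℕ) : Prop :=
  ∃ 𝒜 : Set (Set E), 𝒜.Finite ∧ 𝒜 ⊆ ℰ ∧
    ∀ T ∈ ℰ, ∃ S ∈ 𝒜, PIso G (bt ℰ S r) S (bt ℰ T r) T

/-- A tiling of `E`. -/
def IsTiling (𝒯 : Set (Set E)) : Prop :=
  (∀ T ∈ 𝒯, IsTile T) ∧ ⋃₀ 𝒯 = univ ∧
    ∀ r : ℕ, 1 ≤ r →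
      (∀ T ∈ 𝒯, (bt 𝒯 T r).Finite ∧ ⋃₀ (bt 𝒯 T (r - 1)) ⊆ interior (⋃₀ (bt 𝒯 T r))) ∧
      (∀ S ∈ 𝒯, ∀ T ∈ 𝒯, PLe G (bt 𝒯 S r) S (bt 𝒯 T r) T →
        PIso G (bt 𝒯 S r) S (bt 𝒯 T r) T) ∧
      FinClasses G 𝒯 r

/-- Standing hypothesis on the `q`-local rule `Δ`: no nontrivial element of `G` fixes all
the tiles of some `B_{q-1}^{𝒟_i}(D_i)`. -/
def RigidRule (Δ : LocalRule E G) : Prop :=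
  ∀ i, ∀ σ ∈ G, (∀ T ∈ bt (Δ.C i) (Δ.c i) (Δ.p - 1), tmap σ T = T) → σ = 1

/-- A patch. -/
def IsPatch (ℰ : Set (Set E)) : Prop :=
  ∀ S ∈ ℰ, ∀ T ∈ ℰ, ∃ r : ℕ, T ∈ bt ℰ S r

/-- `I_Γ(ℰ)`. -/
def IRule (Γ : LocalRule E G) (ℰ : Set (Set E)) : Set (Set E) :=
  {T | T ∈ ℰ ∧ ∃ i, PIso G (bt ℰ T Γ.p) T (Γ.C i) (Γ.c i)}

/-- A `Γ`-patch. -/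
def IsRulePatch (Γ : LocalRule E G) (ℰ : Set (Set E)) : Prop :=
  (∀ T ∈ ℰ, ∃ i, PLe G (bt ℰ T Γ.p) T (Γ.C i) (Γ.c i)) ∧
    ∃ 𝒜 ⊆ IRule G Γ ℰ, IsPatch 𝒜 ∧ ℰ = ⋃ T ∈ 𝒜, bt ℰ T Γ.p

/-- The local isomorphism property for a tiling. -/
def TilingLIP (𝒯 : Set (Set E)) : Prop :=
  ∀ ℰ ⊆ 𝒯, IsPatch ℰ → ℰ.Finite →
    ∃ k : ℕ, 1 ≤ k ∧ ∀ T ∈ 𝒯, ∃ σ ∈ G, smap σ ℰ ⊆ bt 𝒯 T k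

/-- `𝒮 ⋐ 𝒯` for tilings: each finite subpatch of `𝒮` is isomorphic to a subpatch of `𝒯`. -/
def TSub (𝒮 𝒯 : Set (Set E)) : Prop :=
  ∀ ℰ ⊆ 𝒮, IsPatch ℰ → ℰ.Finite →
    ∃ ℱ ⊆ 𝒯, IsPatch ℱ ∧ ∃ σ ∈ G, smap σ ℰ = ℱ

/-- Locally isomorphic tilings. -/
def TLocIso (𝒮 𝒯 : Set (Set E)) : Prop := TSub G 𝒮 𝒯 ∧ TSub G 𝒯 𝒮

/-- A rigid tiling: no nontrivial element of `G` leaves it globally invariant. -/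
def TRigid (𝒯 : Set (Set E)) : Prop := ∀ σ ∈ G, smap σ 𝒯 = 𝒯 → σ = 1

lemma tmap_one (T : Set E) : tmap (1 : E ≃ᵢ E) T = T := by
  simp [tmap]

lemma tmap_mul (σ τ : E ≃ᵢ E) (T : Set E) : tmap (σ * τ) T = tmap σ (tmap τ T) := by
  simp [tmap, IsometryEquiv.coe_mul, image_comp]

lemma tmap_inv_eq_iff {σ : E ≃ᵢ E} {S T : Set E} : tmap σ⁻¹ S = T ↔ S = tmap σ T := by
  constructor
  · rintro rfl
    rw [← tmap_mul, mul_inv_cancel, tmap_one]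
  · rintro rfl
    rw [← tmap_mul, inv_mul_cancel, tmap_one]

lemma smap_one (ℰ : Set (Set E)) : smap (1 : E ≃ᵢ E) ℰ = ℰ := by
  simp [smap, tmap_one]

lemma tmap_inter_nonempty (σ : E ≃ᵢ E) (U V : Set E) :
    (tmap σ U ∩ tmap σ V).Nonempty ↔ (U ∩ V).Nonempty := by
  rw [tmap, tmap, ← image_inter σ.injective, image_nonempty]

/-- The sets `B_n` are equivariant under isometries. -/
lemma bt_smap (σ : E ≃ᵢ E) (ℰ : Set (Set E)) (T : Set E) (n : ℕ) :
    bt (smap σ ℰ) (tmap σ T) n = smap σ (bt ℰ T n) := by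
  induction n with
  | zero => simp [bt, smap]
  | succ n ih =>
    ext U
    constructor
    · rintro ⟨⟨U, hU, rfl⟩, V, hV, hUV⟩
      rw [ih] at hV
      obtain ⟨V, hV, rfl⟩ := hV
      exact ⟨U, ⟨hU, V, hV, (tmap_inter_nonempty σ U V).1 hUV⟩, rfl⟩
    · rintro ⟨U, ⟨hU, V, hV, hUV⟩, rfl⟩
      refine ⟨mem_image_of_mem _ hU, tmap σ V, ?_, (tmap_inter_nonempty σ U V).2 hUV⟩
      rw [ih]
      exact mem_image_of_mem _ hV

lemma bt_mono {ℰ ℱ : Set (Set E)} (h : ℰ ⊆ ℱ) (T : Set E) (n : ℕ) :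
    bt ℰ T n ⊆ bt ℱ T n := by
  induction n with
  | zero => exact subset_rfl
  | succ n ih =>
    rintro U ⟨hU, V, hV, hUV⟩
    exact ⟨h hU, V, ih hV, hUV⟩

lemma bt_subset {ℰ : Set (Set E)} {T : Set E} (hT : T ∈ ℰ) (n : ℕ) : bt ℰ T n ⊆ ℰ := by
  cases n with
  | zero => simpa [bt] using hT
  | succ n => exact fun U hU => hU.1

variable {G}

lemma IsTiling.finite_bt {𝒯 : Set (Set E)} (h : IsTiling G 𝒯) {T : Set E} (hT : T ∈ 𝒯)
    (n : ℕ) : (bt 𝒯 T n).Finite := by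
  cases n with
  | zero => exact finite_singleton T
  | succ n => exact ((h.2.2 (n + 1) (by omega)).1 T hT).1

lemma IsTiling.exists_mem {𝒯 : Set (Set E)} (h : IsTiling G 𝒯) (x : E) :
    ∃ T ∈ 𝒯, x ∈ T := by
  have hx : x ∈ ⋃₀ 𝒯 := h.2.1 ▸ mem_univ x
  exact hx

/-- A tiling is locally finite. -/
lemma IsTiling.finite_meeting_nhds {𝒯 : Set (Set E)} (h : IsTiling G 𝒯) (x : E) :
    ∃ N ∈ nhds x, {U ∈ 𝒯 | (U ∩ N).Nonempty}.Finite := by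
  obtain ⟨T, hT, hxT⟩ := h.exists_mem x
  refine ⟨⋃₀ bt 𝒯 T 1, mem_interior_iff_mem_nhds.1 (((h.2.2 1 le_rfl).1 T hT).2
    ⟨T, rfl, hxT⟩), (h.finite_bt hT 2).subset ?_⟩
  rintro U ⟨hU, z, hzU, V, hV, hzV⟩
  exact ⟨hU, V, hV, z, hzU, hzV⟩

lemma IsTiling.finite_meeting_compact {𝒯 : Set (Set E)} (h : IsTiling G 𝒯) {K : Set E}
    (hK : IsCompact K) : {U ∈ 𝒯 | (U ∩ K).Nonempty}.Finite := by
  choose N hN hfin using h.finite_meeting_nhds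
  obtain ⟨t, -, ht⟩ := hK.elim_nhds_subcover N fun x _ => hN x
  refine (t.finite_toSet.biUnion fun x _ => hfin x).subset ?_
  rintro U ⟨hU, z, hzU, hzK⟩
  obtain ⟨x, hx, hzN⟩ := mem_iUnion₂.1 (ht hzK)
  exact mem_biUnion hx ⟨hU, z, hzU, hzN⟩

/-- If `𝒯` satisfies a rigid local rule, an element of `G` fixing all the tiles of some
`B_{p-1}^𝒯(T)` is trivial. -/
lemma RigidRule.eq_one_of_fixes {Δ : LocalRule E G} (hΔ : RigidRule G Δ) {𝒯 : Set (Set E)}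
    (hsat : Satisfies G Δ 𝒯) {T : Set E} (hT : T ∈ 𝒯) {ρ : E ≃ᵢ E} (hρ : ρ ∈ G)
    (hfix : ∀ U ∈ bt 𝒯 T (Δ.p - 1), tmap ρ U = U) : ρ = 1 := by
  obtain ⟨i, τ, hτ, hC, hc⟩ := hsat T hT
  have hconj : τ * ρ * τ⁻¹ = 1 := by
    refine hΔ i _ (G.mul_mem (G.mul_mem hτ hρ) (G.inv_mem hτ)) ?_
    rw [← hC, ← hc, bt_smap]
    rintro _ ⟨U, hU, rfl⟩
    rw [tmap_mul, tmap_mul, tmap_inv_eq_iff.2 rfl, hfix U (bt_mono (bt_subset hT _) _ _ hU)]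
  simpa using hconj

/-- Only finitely many symmetries of a tiling satisfying a rigid local rule map one given tile
into a given finite set of tiles. -/
lemma IsTiling.finite_symmetries_of_tmap_mem {Δ : LocalRule E G} (hΔ : RigidRule G Δ)
    {𝒯 : Set (Set E)} (h : IsTiling G 𝒯) (hsat : Satisfies G Δ 𝒯) {T : Set E} (hT : T ∈ 𝒯)
    {𝒜 : Set (Set E)} (h𝒜 : 𝒜 ⊆ 𝒯) (hfin : 𝒜.Finite) :
    {σ : E ≃ᵢ E | σ ∈ G ∧ smap σ 𝒯 = 𝒯 ∧ tmap σ T ∈ 𝒜}.Finite := by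
  have hB := h.finite_bt hT (Δ.p - 1)
  have hR : (⋃ S ∈ 𝒜, bt 𝒯 S (Δ.p - 1)).Finite :=
    hfin.biUnion fun S hS => h.finite_bt (h𝒜 hS) _
  have := hB.to_subtype
  refine Set.Finite.of_finite_image (f := fun (σ : E ≃ᵢ E) (U : bt 𝒯 T (Δ.p - 1)) =>
    tmap σ (U : Set E)) ((Set.Finite.pi' fun _ => hR).subset ?_) ?_
  · rintro _ ⟨σ, ⟨-, hσ, hσT⟩, rfl⟩ U
    refine mem_biUnion hσT ?_
    have hbt := bt_smap σ 𝒯 T (Δ.p - 1)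
    rw [hσ] at hbt
    rw [hbt]
    exact mem_image_of_mem _ U.2
  · rintro σ ⟨hσ, -, -⟩ τ ⟨hτ, -, -⟩ heq
    refine (inv_mul_eq_one.1 (hΔ.eq_one_of_fixes hsat hT
      (G.mul_mem (G.inv_mem hσ) hτ) fun U hU => ?_))
    rw [tmap_mul, tmap_inv_eq_iff]
    exact (congrFun heq ⟨U, hU⟩).symm

/-- **Proposition 1.8.** For each tiling `𝒯` which satisfies `Δ`, the subgroup
`H = {σ ∈ G : 𝒯σ = 𝒯}` is discrete; indeed `{σ ∈ H : xσ ∈ β(y,η)}` is finite for every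
`η > 0` and all `x, y ∈ E`. -/
theorem prop_1_8 {E : Type*} [MetricSpace E] [ConnectedSpace E]
    (hcomp : ∀ (x : E) (η : ℝ), IsCompact (Metric.closedBall x η))
    (G : Subgroup (E ≃ᵢ E)) (Δ : LocalRule E G) (hΔ : RigidRule G Δ)
    (𝒯 : Set (Set E)) (htiling : IsTiling G 𝒯) (hsat : Satisfies G Δ 𝒯) :
    (∀ x : E, ∃ η : ℝ, 0 < η ∧
        {y : E | ∃ σ ∈ G, smap σ 𝒯 = 𝒯 ∧ σ x = y} ∩ closedBall x η = {x}) ∧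
      ∀ (η : ℝ), 0 < η → ∀ x y : E,
        {σ : E ≃ᵢ E | σ ∈ G ∧ smap σ 𝒯 = 𝒯 ∧ σ x ∈ closedBall y η}.Finite := by
  have key : ∀ (η : ℝ) (x y : E),
      {σ : E ≃ᵢ E | σ ∈ G ∧ smap σ 𝒯 = 𝒯 ∧ σ x ∈ closedBall y η}.Finite := by
    intro η x y
    obtain ⟨T, hT, hxT⟩ := htiling.exists_mem x
    refine (htiling.finite_symmetries_of_tmap_mem hΔ hsat hT (sep_subset _ _)
      (htiling.finite_meeting_compact (hcomp y η))).subset ?_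
    rintro σ ⟨hσ, hσ𝒯, hσx⟩
    refine ⟨hσ, hσ𝒯, ?_, σ x, mem_image_of_mem _ hxT, hσx⟩
    have hmem : tmap σ T ∈ smap σ 𝒯 := mem_image_of_mem _ hT
    rwa [hσ𝒯] at hmem
  refine ⟨fun x => ?_, fun η _ => key η⟩
  have hfin : ((fun σ : E ≃ᵢ E => σ x) ''
      {σ : E ≃ᵢ E | σ ∈ G ∧ smap σ 𝒯 = 𝒯 ∧ σ x ∈ closedBall x 1} \ {x}).Finite :=
    ((key 1 x x).image _).sdiff
  obtain ⟨ε, hε, hball⟩ := nhds_basis_closedBall.mem_iff.1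
    (hfin.isClosed.isOpen_compl.mem_nhds fun hx => hx.2 rfl)
  refine ⟨min ε 1, lt_min hε one_pos, Subset.antisymm ?_ ?_⟩
  · rintro _ ⟨⟨σ, hσ, hσ𝒯, rfl⟩, hdist⟩
    by_contra hne
    exact hball (closedBall_subset_closedBall (min_le_left _ _) hdist)
      ⟨⟨σ, ⟨hσ, hσ𝒯, closedBall_subset_closedBall (min_le_right _ _) hdist⟩, rfl⟩, hne⟩
  · rintro _ rfl
    exact ⟨⟨1, G.one_mem, smap_one 𝒯, rfl⟩,
      mem_closedBall_self (lt_min hε one_pos).le⟩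


end Paper
end

section
/- Let 𝓛 be a finite relational language and let M,N be locally isomorphic uniformly locally finite 𝓛-structures with M connected. Let r ≥ 1 and s ∈ ℕ. Suppose there exists an automorphism g of N such that yg ∈ B_N(y,r) for each y ∈ N and such that {y ∈ N : yg = y} contains no ball B_N(z,s). Then there exists an automorphism f of M such that yf ∈ B_M(y,r) for each y ∈ M and such that {y ∈ M : yf = y} contains no ball B_M(z,s). (Corollary 3.2) -/
open FirstOrder FirstOrder.Language Set

namespace Paper

universe u v

variable (L : FirstOrder.Language)

/-- The ball `B_M(u,h)` of a relational structure. -/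
def rball {M : Type*} [L.Structure M] (u : M) : ℕ → Set M
  | 0 => {u}
  | h + 1 => rball u h ∪ {v | ∃ (k : ℕ) (R : L.Relations k) (t : Fin k → M),
      Structure.RelMap R t ∧ (∃ i, t i ∈ rball u h) ∧ ∃ j, t j = v}

/-- A connected structure. -/
def Conn (M : Type*) [L.Structure M] : Prop :=
  ∃ u : M, ∀ v : M, ∃ h : ℕ, v ∈ rball L u h

/-- A locally finite structure. -/
def LocFin (M : Type*) [L.Structure M] : Prop :=
  ∀ u : M, (rball L u 1).Finite

/-- A uniformly locally finite structure. -/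
def UnifLocFin (M : Type*) [L.Structure M] : Prop :=
  ∃ r : ℕ, ∀ u : M, (rball L u 1).Finite ∧ (rball L u 1).ncard ≤ r

/-- A pointed isomorphism `(s,u) ≅ (t,v)` between the substructures induced on subsets. -/
def PointedIso {M : Type*} {N : Type*} [L.Structure M] [L.Structure N]
    (s : Set M) (u : M) (t : Set N) (v : N) : Prop :=
  ∃ f : s ≃ t,
    (∀ (k : ℕ) (R : L.Relations k) (x : Fin k → s),
      Structure.RelMap R (fun i => (x i : M)) ↔ Structure.RelMap R (fun i => (f (x i) : N))) ∧
    ∀ hu : u ∈ s, (f ⟨u, hu⟩ : N) = v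

/-- The local isomorphism property for a structure. -/
def RelLIP (M : Type*) [L.Structure M] : Prop :=
  ∀ (u : M) (h : ℕ), ∃ k : ℕ, ∀ v : M, ∃ w ∈ rball L v k,
    PointedIso L (rball L w h) w (rball L u h) u

/-- `M ⋐ N`. -/
def RelSub (M : Type*) (N : Type*) [L.Structure M] [L.Structure N] : Prop :=
  ∀ (u : M) (h : ℕ),
    (∃ g : {v : M | PointedIso L (rball L v h) v (rball L u h) u} →
        {w : N | PointedIso L (rball L w h) w (rball L u h) u}, Function.Injective g) ∨
    ({v : M | PointedIso L (rball L v h) v (rball L u h) u}.Infinite ∧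
      {w : N | PointedIso L (rball L w h) w (rball L u h) u}.Infinite)

/-- Locally isomorphic structures. -/
def RelLocIso (M : Type*) (N : Type*) [L.Structure M] [L.Structure N] : Prop :=
  RelSub L M N ∧ RelSub L N M

/-- A rigid structure: no nontrivial automorphism. -/
def Rigid (M : Type*) [L.Structure M] : Prop :=
  ∀ f : M ≃[L] M, ∀ x : M, f x = x

/-- A periodic connected structure. -/
def Periodic (M : Type*) [L.Structure M] : Prop :=
  ∃ A : Set M, A.Finite ∧ ∀ x : M, ∃ σ : M ≃[L] M, ∃ a ∈ A, σ a = x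

/-- A period: `M` is the disjoint union of the sets `Aσ`, `σ ∈ Aut(M)`. -/
def IsPeriod {M : Type*} [L.Structure M] (A : Set M) : Prop :=
  ∀ x : M, ∃! σ : M ≃[L] M, x ∈ (fun a => σ a) '' A

/-- `M` is periodic of periodicity rank `r`. -/
def HasRank (M : Type*) [L.Structure M] (r : ℕ) : Prop :=
  ∃ A : Set M, IsPeriod L A ∧ A.Finite ∧ A.ncard = r

/-- An equational structure. -/
def Equational (M : Type*) [L.Structure M] : Prop :=
  ∀ (k : ℕ) (R : L.Relations k) (x y : Fin k → M),
    Structure.RelMap R x → Structure.RelMap R y → (∃ i, x i = y i) → ∀ j, x j = y j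

/-- `x(R,i,j) = y`. -/
def rstep {M : Type*} [L.Structure M] {k : ℕ} (R : L.Relations k) (i j : Fin k)
    (x y : M) : Prop :=
  i ≠ j ∧ ∃ t : Fin k → M, Structure.RelMap R t ∧ t i = x ∧ t j = y

/-- Words over the alphabet of triples `(R,i,j)`. -/
def Word (L : FirstOrder.Language) : Type _ :=
  List ((k : ℕ) × (L.Relations k × Fin k × Fin k))

/-- `xw = y` for a word `w`. -/
def wrel {M : Type*} [L.Structure M] : Word L → M → M → Prop
  | [], x, y => x = y
  | ⟨_, R, i, j⟩ :: w, x, y => ∃ z, rstep L R i j x z ∧ wrel w z y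

/-- A partial isomorphism from `B_M(x,r)` to `N`. -/
def PartialIso {M : Type*} {N : Type*} [L.Structure M] [L.Structure N]
    (x : M) (r : ℕ) (ρ : rball L x r → N) : Prop :=
  Function.Injective ρ ∧
    ∀ (k : ℕ) (R : L.Relations k) (i j : Fin k), i ≠ j →
      ∀ y z : rball L x r,
        ((∃ y' : M, rstep L R i j (y : M) y') ↔ (∃ y' : N, rstep L R i j (ρ y) y')) ∧
        (rstep L R i j (y : M) (z : M) ↔ rstep L R i j (ρ y) (ρ z))

/-- A commutative equational structure. -/
def Comm (M : Type*) [L.Structure M] : Prop :=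
  ∀ (x : M) (r : ℕ), 1 ≤ r → ∀ ρ : rball L x r → M, PartialIso L x r ρ →
    ∀ σ : M ≃[L] M, ∀ y : rball L x r, ∀ h : σ (y : M) ∈ rball L x r,
      σ (ρ y) = ρ ⟨σ (y : M), h⟩

/-- The strong regularity condition between two structures. -/
def SRcond (M : Type*) (N : Type*) [L.Structure M] [L.Structure N] : Prop :=
  ∀ (w : Word L) (x : M) (y : N),
    (∃ x' : M, wrel L w x x') → (∃ y' : N, wrel L w y y') →
      (wrel L w x x ↔ wrel L w y y)

/-- A weakly connected subset. -/
def WeaklyConnected {M : Type*} [L.Structure M] (A : Set M) : Prop :=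
  ∀ B : Set M, B ⊆ A → B.Nonempty → B ≠ A →
    ∃ (k : ℕ) (R : L.Relations k) (t : Fin k → M), 2 ≤ k ∧ Structure.RelMap R t ∧
      (∃ i, t i ∈ B) ∧ ∃ j, t j ∈ A \ B

section Balls

variable {M : Type*} [L.Structure M]

theorem rball_mono {u : M} {h k : ℕ} (hk : h ≤ k) : rball L u h ⊆ rball L u k := by
  induction hk with
  | refl => exact Subset.rfl
  | step _ ih => exact ih.trans subset_union_left

theorem mem_rball_self (u : M) (h : ℕ) : u ∈ rball L u h :=
  rball_mono L (Nat.zero_le h) rfl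

theorem rball_trans {u v w : M} {h k : ℕ} (hv : v ∈ rball L u h) (hw : w ∈ rball L v k) :
    w ∈ rball L u (h + k) := by
  induction k generalizing w with
  | zero =>
    obtain rfl : w = v := hw
    exact hv
  | succ k ih =>
    rcases hw with hw | ⟨n, R, t, ht, ⟨i, hi⟩, hj⟩
    · exact Or.inl (ih hw)
    · exact Or.inr ⟨n, R, t, ht, ⟨i, ih hi⟩, hj⟩

theorem rball_symm {u v : M} {h : ℕ} (hv : v ∈ rball L u h) : u ∈ rball L v h := by
  induction h generalizing v with
  | zero => exact Eq.symm hv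
  | succ h ih =>
    rcases hv with hv | ⟨n, R, t, ht, ⟨i, hi⟩, ⟨j, rfl⟩⟩
    · exact Or.inl (ih hv)
    · have hij : t i ∈ rball L (t j) 1 := Or.inr ⟨n, R, t, ht, ⟨j, rfl⟩, ⟨i, rfl⟩⟩
      rw [Nat.add_comm]
      exact rball_trans L hij (ih hi)

theorem rball_succ_subset (u : M) (h : ℕ) :
    rball L u (h + 1) ⊆ ⋃ w ∈ rball L u h, rball L w 1 := by
  rintro v (hv | ⟨n, R, t, ht, ⟨i, hi⟩, hj⟩)
  · exact mem_biUnion hv (mem_rball_self L v 1)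
  · exact mem_biUnion hi (Or.inr ⟨n, R, t, ht, ⟨i, rfl⟩, hj⟩)

theorem LocFin.finite_rball (hM : LocFin L M) (u : M) (h : ℕ) : (rball L u h).Finite := by
  induction h with
  | zero => exact finite_singleton u
  | succ h ih => exact (ih.biUnion fun w _ => hM w).subset (rball_succ_subset L u h)

end Balls

theorem map_mem_rball {M N : Type*} [L.Structure M] [L.Structure N] {s : Set M} {t : Set N}
    (f : s → t)
    (hf : ∀ (k : ℕ) (R : L.Relations k) (x : Fin k → s),
      Structure.RelMap R (fun i => (x i : M)) → Structure.RelMap R (fun i => (f (x i) : N)))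
    (y : s) {h : ℕ} (hs : rball L (y : M) h ⊆ s) (w : s) (hw : (w : M) ∈ rball L (y : M) h) :
    (f w : N) ∈ rball L (f y : N) h := by
  induction h generalizing w with
  | zero =>
    obtain rfl : w = y := Subtype.ext hw
    exact mem_rball_self L _ _
  | succ h ih =>
    have hs' := (rball_mono L h.le_succ).trans hs
    rcases hw with hw | ⟨n, R, x, hx, ⟨i, hi⟩, ⟨j, hj⟩⟩
    · exact Or.inl (ih hs' w hw)
    · have hmem : ∀ a, x a ∈ s := fun a => hs (Or.inr ⟨n, R, x, hx, ⟨i, hi⟩, ⟨a, rfl⟩⟩)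
      refine Or.inr ⟨n, R, fun a => f ⟨x a, hmem a⟩, hf n R (fun a => ⟨x a, hmem a⟩) hx,
        ⟨i, ih hs' ⟨x i, hmem i⟩ hi⟩, ⟨j, ?_⟩⟩
      exact congrArg (fun z => (f z : N)) (Subtype.ext hj)

theorem RelSub.exists_pointedIso {M N : Type*} [L.Structure M] [L.Structure N]
    (hMN : RelSub L M N) (u : M) (h : ℕ) :
    ∃ w : N, PointedIso L (rball L w h) w (rball L u h) u := by
  rcases hMN u h with ⟨g, -⟩ | ⟨-, hinf⟩
  · exact ⟨_, (g ⟨u, Equiv.refl _, fun _ _ _ => Iff.rfl, fun _ => rfl⟩).2⟩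
  · exact hinf.nonempty

/-- The pointed isomorphisms between larger and larger balls of a connected structure `M` and
balls of `N` yield maps `φ n : M → N` and `ψ n : N → M` which behave like mutually inverse
isomorphisms on any given ball of `M` once `n` is large. -/
theorem RelSub.exists_approx {M N : Type*} [L.Structure M] [L.Structure N]
    (hMN : RelSub L M N) (hM : Conn L M) :
    ∃ (φ : ℕ → M → N) (ψ : ℕ → N → M),
      (∀ y, ∀ᶠ n in Filter.atTop, ψ n (φ n y) = y) ∧
      (∀ (k : ℕ) (R : L.Relations k) (t : Fin k → M), ∀ᶠ n in Filter.atTop,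
        Structure.RelMap R t ↔ Structure.RelMap R (fun i => φ n (t i))) ∧
      ∀ (y : M) (h : ℕ), ∀ᶠ n in Filter.atTop, ∀ w ∈ rball L (φ n y) h,
        ψ n w ∈ rball L y h ∧ φ n (ψ n w) = w := by
  classical
  obtain ⟨u, hu⟩ := hM
  choose c hc using hMN.exists_pointedIso L u
  choose e he hcu using hc
  have hmem : ∀ y, ∀ᶠ n in Filter.atTop, y ∈ rball L u n := fun y => by
    obtain ⟨d, hd⟩ := hu y
    filter_upwards [Filter.eventually_ge_atTop d] with n hn using rball_mono L hn hd
  let φ : ℕ → M → N := fun n y => if hy : y ∈ rball L u n then ((e n).symm ⟨y, hy⟩ : N) else c n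
  let ψ : ℕ → N → M := fun n w => if hw : w ∈ rball L (c n) n then (e n ⟨w, hw⟩ : M) else u
  have hφ : ∀ n y (hy : y ∈ rball L u n), φ n y = (e n).symm ⟨y, hy⟩ :=
    fun n y hy => dif_pos hy
  have hψ : ∀ n w (hw : w ∈ rball L (c n) n), ψ n w = e n ⟨w, hw⟩ := fun n w hw => dif_pos hw
  have hψφ : ∀ n y, y ∈ rball L u n → ψ n (φ n y) = y := fun n y hy => by
    rw [hφ n y hy, hψ n _ (Subtype.prop _)]
    simp
  have hsymm : ∀ n (k : ℕ) (R : L.Relations k) (x : Fin k → rball L u n),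
      Structure.RelMap R (fun i => (x i : M)) ↔
        Structure.RelMap R (fun i => ((e n).symm (x i) : N)) := fun n k R x => by
    simpa using (he n k R fun i => (e n).symm (x i)).symm
  have hcenter : ∀ n (hn : u ∈ rball L u n), ((e n).symm ⟨u, hn⟩ : N) = c n := fun n hn => by
    have : e n ⟨c n, mem_rball_self L _ _⟩ = ⟨u, hn⟩ := Subtype.ext (hcu n _)
    rw [← this, Equiv.symm_apply_apply]
  refine ⟨φ, ψ, fun y => (hmem y).mono fun n => hψφ n y, fun k R t => ?_, fun y h => ?_⟩
  · filter_upwards [Filter.eventually_all.2 fun i => hmem (t i)] with n hn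
    have := hsymm n k R fun i => ⟨t i, hn i⟩
    simpa only [fun i => hφ n (t i) (hn i)] using this
  · obtain ⟨d, hd⟩ := hu y
    filter_upwards [Filter.eventually_ge_atTop (d + h)] with n hn w hw
    have hdn : rball L u d ⊆ rball L u n := rball_mono L (by omega)
    have hφy : φ n y ∈ rball L (c n) d := by
      have := map_mem_rball L (e n).symm (fun k R x => (hsymm n k R x).1)
        ⟨u, mem_rball_self L u n⟩ hdn ⟨y, hdn hd⟩ hd
      rwa [hcenter, ← hφ] at this
    have hball : rball L (φ n y) h ⊆ rball L (c n) n := fun z hz =>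
      rball_mono L hn (rball_trans L hφy hz)
    have hwn := hball hw
    constructor
    · have := map_mem_rball L (e n) (fun k R x => (he n k R x).1)
        ⟨φ n y, hball (mem_rball_self L _ _)⟩ hball ⟨w, hwn⟩ hw
      rwa [← hψ, ← hψ, hψφ n y (hdn hd)] at this
    · rw [hψ n w hwn, hφ n _ (Subtype.prop _)]
      simp

theorem exists_eventually_eq_of_mem_finite {ι α : Type*} (U : Ultrafilter ι) {F : ι → α}
    {s : Set α} (hs : s.Finite) (hF : ∀ᶠ n in (U : Filter ι), F n ∈ s) :
    ∃ a ∈ s, ∀ᶠ n in (U : Filter ι), F n = a :=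
  (Ultrafilter.eventually_exists_mem_iff hs).1 (hF.mono fun _ hn => ⟨_, hn, rfl⟩)

/-- **Corollary 3.2.** Let `M, N` be locally isomorphic uniformly locally finite
`L`-structures with `M` connected, `r ≥ 1` and `s ∈ ℕ`. If `N` has an automorphism `g`
with `yg ∈ B_N(y,r)` for all `y` whose fixed-point set contains no ball `B_N(z,s)`, then
`M` has an automorphism `f` with `yf ∈ B_M(y,r)` for all `y` whose fixed-point set
contains no ball `B_M(z,s)`. -/
theorem cor_3_2 [L.IsRelational] (hLfin : Finite ((k : ℕ) × L.Relations k))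
    (M : Type u) (N : Type v) [L.Structure M] [L.Structure N]
    (hloc : RelLocIso L M N) (hMulf : UnifLocFin L M) (hNulf : UnifLocFin L N)
    (hMconn : Conn L M) (r : ℕ) (hr : 1 ≤ r) (s : ℕ)
    (g : N ≃[L] N) (hgr : ∀ y : N, g y ∈ rball L y r)
    (hgfix : ∀ z : N, ¬ rball L z s ⊆ {y : N | g y = y}) :
    ∃ f : M ≃[L] M, (∀ y : M, f y ∈ rball L y r) ∧
      ∀ z : M, ¬ rball L z s ⊆ {y : M | f y = y} := by
  have hMfin : LocFin L M := by
    obtain ⟨_, h⟩ := hMulf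
    exact fun u => (h u).1
  obtain ⟨φ, ψ, hψφ, hrel, hball⟩ := hloc.1.exists_approx L hMconn
  let U : Ultrafilter ℕ := Filter.hyperfilter ℕ
  have hU : ∀ {p : ℕ → Prop}, (∀ᶠ n in Filter.atTop, p n) → ∀ᶠ n in (U : Filter ℕ), p n :=
    fun hp => hp.filter_mono Nat.hyperfilter_le_atTop
  have hlimit : ∀ σ : N → N, (∀ y, σ y ∈ rball L y r) → ∃ f : M → M,
      (∀ y, f y ∈ rball L y r) ∧ ∀ y, ∀ᶠ n in (U : Filter ℕ), φ n (f y) = σ (φ n y) := by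
    intro σ hσ
    have hpt : ∀ y, ∃ a ∈ rball L y r, ∀ᶠ n in (U : Filter ℕ), φ n a = σ (φ n y) := fun y => by
      have hy := hU (hball y r)
      obtain ⟨a, ha, hFa⟩ := exists_eventually_eq_of_mem_finite U
        (F := fun n => ψ n (σ (φ n y))) (hMfin.finite_rball L y r)
        (hy.mono fun n hn => (hn _ (hσ _)).1)
      refine ⟨a, ha, ?_⟩
      filter_upwards [hy, hFa] with n hn hna
      rw [← hna]
      exact (hn _ (hσ _)).2
    choose f hf hfσ using hpt
    exact ⟨f, hf, hfσ⟩
  have hinj : ∀ a b : M, (∀ᶠ n in (U : Filter ℕ), φ n a = φ n b) → a = b := by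
    intro a b hab
    obtain ⟨n, hn, ha, hb⟩ := (hab.and ((hU (hψφ a)).and (hU (hψφ b)))).exists
    rw [← ha, hn, hb]
  obtain ⟨f, hf, hfg⟩ := hlimit g hgr
  obtain ⟨f', -, hfg'⟩ := hlimit g.symm fun y => rball_symm L (by simpa using hgr (g.symm y))
  refine ⟨⟨⟨f, f', fun y => hinj _ _ ?_, fun y => hinj _ _ ?_⟩, fun c => isEmptyElim c,
    fun {k} R t => ?_⟩, hf, fun z hz => ?_⟩
  · filter_upwards [hfg y, hfg' (f y)] with n h1 h2
    rw [h2, h1, g.symm_apply_apply]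
  · filter_upwards [hfg' y, hfg (f' y)] with n h1 h2
    rw [h2, h1, g.apply_symm_apply]
  · obtain ⟨n, h1, h2, h3⟩ := ((Filter.eventually_all.2 fun i => hfg (t i)).and
      ((hU (hrel k R t)).and (hU (hrel k R fun i => f (t i))))).exists
    change Structure.RelMap R (fun i => f (t i)) ↔ Structure.RelMap R t
    rw [h2, h3]
    simp only [h1]
    exact g.map_rel R fun i => φ n (t i)
  · have hfix : ∀ᶠ n in (U : Filter ℕ), ∀ y ∈ rball L z s, g (φ n y) = φ n y :=
      (Filter.eventually_all_finite (hMfin.finite_rball L z s)).2 fun y hy =>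
        (hfg y).mono fun n hn => hn.symm.trans (congrArg (φ n) (hz hy))
    obtain ⟨n, h1, h2⟩ := (hfix.and (hU (hball z s))).exists
    refine hgfix (φ n z) fun w hw => ?_
    obtain ⟨hw1, hw2⟩ := h2 w hw
    have := h1 _ hw1
    rwa [hw2] at this

end Paper
end
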